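/- Let 𝔤 be a finite-dimensional simple Lie algebra over ℂ and let R be a nontrivial commutative ring equipped with a ℂ-algebra structure. Then the R-module of R-bilinear alternating maps f : 𝔤_R × 𝔤_R → 𝔤_R satisfying f([z,x],y) + f(x,[z,y]) = [z, f(x,y)] for all x, y, z ∈ 𝔤_R is free of rank one, generated by the Lie bracket of 𝔤_R. -/

import Mathlib

open TensorProduct

/-- The Lie bracket of a Lie algebra over `R` as an `R`-bilinear map. -/
def bracketBilin (R L : Type*) [CommRing R] [LieRing L] [LieAlgebra R L] :
    L →ₗ[R] L →ₗ[R] L :=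
  LinearMap.mk₂ R (fun x y => ⁅x, y⁆)
    (fun _ _ _ => by simp) (fun _ _ _ => by simp)
    (fun _ _ _ => by simp) (fun _ _ _ => by simp)

/-- The `R`-module of alternating `R`-bilinear maps `f : L × L → L` satisfying the
invariance condition `f([z,x],y) + f(x,[z,y]) = [z, f(x,y)]`. -/
def invAltMaps (R L : Type*) [CommRing R] [LieRing L] [LieAlgebra R L] :
    Submodule R (L →ₗ[R] L →ₗ[R] L) where
  carrier := {f | (∀ x, f x x = 0) ∧
    ∀ (z x y : L), f ⁅z, x⁆ y + f x ⁅z, y⁆ = ⁅z, f x y⁆}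
  add_mem' := by
    rintro f g ⟨hf1, hf2⟩ ⟨hg1, hg2⟩
    refine ⟨fun x => by simp [hf1 x, hg1 x], fun z x y => ?_⟩
    simp only [LinearMap.add_apply, lie_add]
    rw [← hf2 z x y, ← hg2 z x y]
    abel
  zero_mem' := ⟨fun x => rfl, fun z x y => by simp⟩
  smul_mem' := by
    rintro c f ⟨hf1, hf2⟩
    refine ⟨fun x => by simp [hf1 x], fun z x y => ?_⟩
    simp only [LinearMap.smul_apply, lie_smul]
    rw [← hf2 z x y, smul_add]

open LieAlgebra LieModule LieAlgebra.IsKilling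

lemma bracketBilin_mem_invAltMaps (R L : Type*) [CommRing R] [LieRing L] [LieAlgebra R L] :
    bracketBilin R L ∈ invAltMaps R L :=
  ⟨fun x => lie_self x, fun z x y => (leibniz_lie z x y).symm⟩

lemma apply_swap_of_mem_invAltMaps {R L : Type*} [CommRing R] [LieRing L] [LieAlgebra R L]
    {F : L →ₗ[R] L →ₗ[R] L} (hF : F ∈ invAltMaps R L) (x y : L) : F x y = -F y x := by
  have h := hF.1 (x + y)
  simp only [map_add, LinearMap.add_apply, hF.1, zero_add, add_zero] at h
  exact eq_neg_of_add_eq_zero_right h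

/-- The left kernel of an invariant alternating map is an ideal. -/
def leftKerIdeal {R L : Type*} [CommRing R] [LieRing L] [LieAlgebra R L]
    {F : L →ₗ[R] L →ₗ[R] L} (hF : F ∈ invAltMaps R L) : LieIdeal R L where
  __ := LinearMap.ker F
  lie_mem {z x} hx := by
    have hx' : F x = 0 := hx
    change F ⁅z, x⁆ = 0
    ext y
    simpa [hx'] using hF.2 z x y

lemma coe_lie_coe_eq_zero {K L : Type*} [Field K] [LieRing L] [LieAlgebra K L]
    [FiniteDimensional K L] [IsKilling K L] {H : LieSubalgebra K L} [H.IsCartanSubalgebra]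
    (h h' : H) : ⁅(h : L), (h' : L)⁆ = 0 := by
  rw [← LieSubalgebra.coe_bracket, trivial_lie_zero, ZeroMemClass.coe_zero]

section Killing

variable {K L : Type*} [Field K] [CharZero K] [LieRing L] [LieAlgebra K L]
  [FiniteDimensional K L] [IsKilling K L] {H : LieSubalgebra K L} [H.IsCartanSubalgebra]
  [IsTriangularizable K H L] {F : L →ₗ[K] L →ₗ[K] L}

lemma coe_lie_eq_smul_of_mem_rootSpace {χ : H → K} {y : L} (hy : y ∈ rootSpace H χ) (h : H) :
    ⁅(h : L), y⁆ = χ h • y :=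
  lie_eq_smul_of_mem_rootSpace hy h

lemma lie_coe_eq_smul_of_mem_rootSpace {χ : H → K} {y : L} (hy : y ∈ rootSpace H χ) (h : H) :
    ⁅y, (h : L)⁆ = -(χ h • y) := by
  rw [← lie_skew, coe_lie_eq_smul_of_mem_rootSpace hy]

lemma exists_smul_eq_of_mem_rootSpace {α : Weight K H L} (hα : α.IsNonZero) {e y : L}
    (he : e ∈ rootSpace H α) (he0 : e ≠ 0) (hy : y ∈ rootSpace H α) : ∃ c : K, c • e = y := by
  obtain ⟨c, hc⟩ := (finrank_eq_one_iff_of_nonzero' (⟨e, he⟩ : rootSpace H α)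
    (by simpa [Subtype.ext_iff] using he0)).1 (finrank_rootSpace_eq_one α hα) ⟨y, hy⟩
  exact ⟨c, congrArg Subtype.val hc⟩

lemma apply_mem_rootSpace_of_mem_invAltMaps (hF : F ∈ invAltMaps K L) (h : H) {χ : H → K} {y : L}
    (hy : y ∈ rootSpace H χ) : F h y ∈ rootSpace H χ := by
  refine weightSpace_le_genWeightSpace L χ ((mem_weightSpace _ _).2 fun h' => ?_)
  have key := hF.2 (h' : L) h y
  rw [coe_lie_coe_eq_zero, coe_lie_eq_smul_of_mem_rootSpace hy] at key
  simpa using key.symm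

lemma exists_lie_eq_coroot {α : Weight K H L} (hα : α.IsNonZero) :
    ∃ e f : L, e ∈ rootSpace H α ∧ f ∈ rootSpace H (-α : Weight K H L) ∧ e ≠ 0 ∧ f ≠ 0 ∧
      ⁅e, f⁆ = (coroot α : L) := by
  obtain ⟨h, e, f, t, he, hf⟩ := exists_isSl2Triple_of_weight_isNonZero hα
  have hh := t.h_eq_coroot hα he hf
  exact ⟨e, f, he, by simpa using hf, t.e_ne_zero, t.f_ne_zero, hh ▸ t.lie_e_f⟩

lemma exists_apply_coroot_eq_smul (hF : F ∈ invAltMaps K L) {α : Weight K H L}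
    (hα : α.IsNonZero) (h : H) : ∃ m : K, F h (coroot α : L) = m • (coroot α : L) := by
  obtain ⟨e, f, he, hf, he0, hf0, hef⟩ := exists_lie_eq_coroot hα
  have hfe : ⁅f, e⁆ = -(coroot α : L) := by rw [← lie_skew, hef]
  have key (h : H) : ∃ l : K, α h • F f e - F h (coroot α : L) = -(l • (coroot α : L)) := by
    obtain ⟨l, hl⟩ := exists_smul_eq_of_mem_rootSpace hα he he0
      (apply_mem_rootSpace_of_mem_invAltMaps hF h he)
    refine ⟨l, ?_⟩
    have := hF.2 f (h : L) e
    rw [← hl, lie_coe_eq_smul_of_mem_rootSpace hf, hfe, lie_smul, hfe] at this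
    simpa [sub_eq_add_neg] using this
  obtain ⟨l, hl⟩ := key h
  obtain ⟨l', hl'⟩ := key (coroot α)
  rw [hF.1, root_apply_coroot hα, sub_zero] at hl'
  have hFfe : F f e = (-(l' / 2)) • (coroot α : L) := by
    rw [← inv_smul_smul₀ (two_ne_zero (α := K)) (F f e), hl']
    module
  refine ⟨α h * (-(l' / 2)) + l, ?_⟩
  rw [hFfe] at hl
  rw [← sub_eq_zero, ← neg_eq_zero, ← sub_eq_zero.2 hl]
  module

lemma apply_coe_coe_eq_zero (hF : F ∈ invAltMaps K L) (h h' : H) : F h h' = 0 := by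
  have base (α β : Weight K H L) (hα : α.IsNonZero) (hβ : β.IsNonZero) :
      F (coroot α : L) (coroot β : L) = 0 := by
    obtain ⟨m, hm⟩ := exists_apply_coroot_eq_smul hF hβ (coroot α)
    obtain ⟨n, hn⟩ := exists_apply_coroot_eq_smul hF hα (coroot β)
    rw [apply_swap_of_mem_invAltMaps hF, hm] at hn
    rcases eq_or_ne n 0 with rfl | hn0
    · rw [hm, ← neg_eq_zero, hn, zero_smul]
    · have : (coroot α : L) = (n⁻¹ * -m) • (coroot β : L) := by
        rw [mul_smul, neg_smul, hn, inv_smul_smul₀ hn0]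
      rw [this, map_smul, LinearMap.smul_apply, hF.1, smul_zero]
  have hspan (h : H) :
      h ∈ Submodule.span K (Set.range fun α : H.root => coroot (α : Weight K H L)) := by
    have h1 : h ∈ Submodule.span K (Set.range (rootSystem H).coroot) := by
      rw [RootPairing.IsRootSystem.span_coroot_eq_top]; trivial
    exact h1
  induction hspan h using Submodule.span_induction with
  | zero => simp
  | add x y _ _ hx hy => simp [hx, hy]
  | smul a x _ hx => simp [hx]
  | mem x hx =>
    obtain ⟨α, rfl⟩ := hx
    induction hspan h' using Submodule.span_induction with
    | zero => simp
    | add x y _ _ hx hy => simp [hx, hy]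
    | smul a x _ hx => simp [hx]
    | mem x hx =>
      obtain ⟨β, rfl⟩ := hx
      exact base _ _ (H.isNonZero_coe_root α) (H.isNonZero_coe_root β)

/-- An invariant alternating map is a multiple of the bracket on each `H × rootSpace H β`. -/
lemma exists_apply_eq_smul_lie (hF : F ∈ invAltMaps K L) {β : Weight K H L} (hβ : β.IsNonZero) :
    ∃ c : K, ∀ h : H, ∀ y ∈ rootSpace H β, F h y = c • ⁅(h : L), y⁆ := by
  obtain ⟨e, -, he, -, he0, -⟩ := exists_lie_eq_coroot hβ
  obtain ⟨l, hl⟩ := exists_smul_eq_of_mem_rootSpace hβ he he0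
    (apply_mem_rootSpace_of_mem_invAltMaps hF (coroot β) he)
  refine ⟨l / 2, fun h y hy => ?_⟩
  obtain ⟨a, rfl⟩ := exists_smul_eq_of_mem_rootSpace hβ he he0 hy
  have key := hF.2 e (h : L) (coroot β : L)
  rw [apply_coe_coe_eq_zero hF, lie_zero, lie_coe_eq_smul_of_mem_rootSpace he,
    lie_coe_eq_smul_of_mem_rootSpace he, root_apply_coroot hβ, map_neg, map_smul,
    LinearMap.neg_apply, LinearMap.smul_apply, apply_swap_of_mem_invAltMaps hF e, ← hl, map_neg,
    map_smul] at key
  have : F h e = (l / 2 * β h) • e := by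
    linear_combination (norm := module) (-(1 / 2) : K) • key
  rw [map_smul, this, lie_smul, coe_lie_eq_smul_of_mem_rootSpace he]
  module

/-- If an invariant alternating map vanishes on `H × rootSpace H α`, then it vanishes on
`H × rootSpace H (-α)`. -/
lemma apply_neg_rootSpace_eq_zero (hF : F ∈ invAltMaps K L) {α : Weight K H L}
    (hα : α.IsNonZero) (h0 : ∀ h : H, ∀ y ∈ rootSpace H α, F h y = 0) (h : H) {y : L}
    (hy : y ∈ rootSpace H (-α : Weight K H L)) : F h y = 0 := by
  obtain ⟨e, f, he, hf, he0, hf0, hef⟩ := exists_lie_eq_coroot hα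
  have hfe : ⁅f, e⁆ = -(coroot α : L) := by rw [← lie_skew, hef]
  obtain ⟨a, rfl⟩ := exists_smul_eq_of_mem_rootSpace hα.neg hf hf0 hy
  obtain ⟨l, hl⟩ := exists_smul_eq_of_mem_rootSpace hα.neg hf hf0
    (apply_mem_rootSpace_of_mem_invAltMaps hF h hf)
  have hFfe : F f e = 0 := by
    have := hF.2 f (coroot α : L) e
    rw [h0 _ e he, lie_coe_eq_smul_of_mem_rootSpace hf, hfe] at this
    simpa [hF.1, root_apply_coroot hα] using this
  have key := hF.2 e (h : L) f
  rw [lie_coe_eq_smul_of_mem_rootSpace he, hef, apply_coe_coe_eq_zero hF, ← hl, lie_smul, hef,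
    map_neg, map_smul, LinearMap.neg_apply, LinearMap.smul_apply,
    apply_swap_of_mem_invAltMaps hF e f, hFfe] at key
  have hl0 : l = 0 := by
    have h2 : (coroot α : L) ≠ 0 := by simpa using hα
    rw [neg_zero, smul_zero, neg_zero, zero_add, eq_comm] at key
    exact (smul_eq_zero.1 key).resolve_right h2
  rw [map_smul, ← hl, hl0, zero_smul, smul_zero]

/-- For a root `β` not proportional to `α`, if `F` vanishes on `H × {e}` and is `c` times the bracket
on `H × {w}`, then `c • ⁅e, w⁆ = 0`. -/
lemma smul_lie_eq_zero_of_apply_eq_zero (hF : F ∈ invAltMaps K L) {α β : Weight K H L}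
    (hα : α.IsNonZero) (hβ : β.IsNonZero) (h1 : β ≠ -α) (h2 : β ≠ α) {e w : L}
    (he : e ∈ rootSpace H α) (hw : w ∈ rootSpace H β) (he0 : ∀ h : H, F h e = 0) {c : K}
    (hc : ∀ h : H, F h w = c • ⁅(h : L), w⁆) : c • ⁅e, w⁆ = 0 := by
  have key (h : H) : (α h - β h) • F w e = β h • c • ⁅e, w⁆ := by
    have k1 := hF.2 w (h : L) e
    have k2 := hF.2 e (h : L) w
    rw [he0, lie_zero, lie_coe_eq_smul_of_mem_rootSpace hw, ← lie_skew w e, map_neg, map_neg,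
      LinearMap.neg_apply, map_smul, LinearMap.smul_apply] at k1
    rw [hc, lie_coe_eq_smul_of_mem_rootSpace he, coe_lie_eq_smul_of_mem_rootSpace hw, lie_smul,
      lie_smul, map_neg, LinearMap.neg_apply, map_smul, LinearMap.smul_apply,
      apply_swap_of_mem_invAltMaps hF e w] at k2
    linear_combination (norm := module) k1 + k2
  by_contra hne
  obtain ⟨φ, hφ⟩ := Module.Projective.exists_dual_ne_zero K hne
  have hk (h : H) : α h * φ (F w e) = β h * (φ (F w e) + φ (c • ⁅e, w⁆)) := by
    have := congrArg φ (key h)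
    simp only [map_smul φ, smul_eq_mul] at this ⊢
    linear_combination this
  by_cases hs : φ (F w e) + φ (c • ⁅e, w⁆) = 0
  · refine hα (funext fun h => ?_)
    have h3 : φ (F w e) ≠ 0 := fun h0 => hφ (by simpa [h0] using hs)
    have h4 := hk h
    rw [hs, mul_zero] at h4
    exact (mul_eq_zero.1 h4).resolve_right h3
  · refine (eq_neg_or_eq_of_eq_smul α β hβ
      (φ (F w e) / (φ (F w e) + φ (c • ⁅e, w⁆))) (funext fun h => ?_)).elim h1 h2
    rw [Pi.smul_apply, smul_eq_mul, div_mul_eq_mul_div, eq_div_iff hs, ← hk h, mul_comm]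

variable (H) in
lemma eq_zero_of_apply_rootSpace_eq_zero [IsSimple K L] (hF : F ∈ invAltMaps K L)
    {α : Weight K H L} (hα : α.IsNonZero) (h0 : ∀ h : H, ∀ y ∈ rootSpace H α, F h y = 0) :
    F = 0 := by
  have h0' (h : H) (y : L) (hy : y ∈ rootSpace H (-α : Weight K H L)) : F h y = 0 :=
    apply_neg_rootSpace_eq_zero hF hα h0 h hy
  have hcor : F (coroot α : L) = 0 := by
    ext y
    have hy : y ∈ (⨆ χ : Weight K H L, rootSpace H χ) := by
      rw [iSup_genWeightSpace_eq_top']; trivial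
    induction hy using LieSubmodule.iSup_induction' with
    | zero => simp
    | add x y _ _ hx hy => simp_all
    | mem β w hw =>
      by_cases hβ : β.IsZero
      · rw [hβ, rootSpace_zero_eq] at hw
        exact apply_coe_coe_eq_zero hF (coroot α) ⟨w, hw⟩
      by_cases h2 : β = α
      · subst h2; exact h0 _ _ hw
      by_cases h1 : β = -α
      · subst h1; exact h0' _ _ hw
      obtain ⟨e, f, he, hf, he0, hf0, hef⟩ := exists_lie_eq_coroot hα
      obtain ⟨c, hc⟩ := exists_apply_eq_smul_lie hF hβ
      have ke := smul_lie_eq_zero_of_apply_eq_zero hF hα hβ h1 h2 he hw (fun h => h0 h e he)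
        (fun h => hc h w hw)
      have kf := smul_lie_eq_zero_of_apply_eq_zero hF hα.neg hβ (by simpa using h2) h1 hf hw
        (fun h => h0' h f hf) (fun h => hc h w hw)
      rw [LinearMap.zero_apply, hc _ w hw, ← hef, lie_lie, smul_sub, ← lie_smul c e ⁅f, w⁆,
        ← lie_smul c f ⁅e, w⁆, ke, kf, lie_zero, lie_zero, sub_zero]
  have htop : leftKerIdeal hF = ⊤ := by
    refine (IsSimple.eq_bot_or_eq_top (R := K) (leftKerIdeal hF)).resolve_left fun hbot => ?_
    have : (coroot α : L) ∈ leftKerIdeal hF := hcor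
    rw [hbot, LieSubmodule.mem_bot] at this
    exact hα (by simpa using this)
  ext x y
  have : x ∈ leftKerIdeal hF := by rw [htop]; trivial
  have hx : F x = 0 := this
  rw [hx, LinearMap.zero_apply, LinearMap.zero_apply, LinearMap.zero_apply]

end Killing

lemma exists_weight_isNonZero {K L : Type*} [Field K] [CharZero K] [LieRing L] [LieAlgebra K L]
    [FiniteDimensional K L] [IsSimple K L] (H : LieSubalgebra K L) [H.IsCartanSubalgebra]
    [IsTriangularizable K H L] : ∃ α : Weight K H L, α.IsNonZero := by
  by_contra! hcon
  have htop := cartan_sup_iSup_rootSpace_eq_top (H := H)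
  have : (⨆ α : Weight K H L, ⨆ (_ : α.IsNonZero), rootSpace H α) = ⊥ := by simp [hcon]
  rw [this, sup_bot_eq] at htop
  refine IsSimple.non_abelian (R := K) (L := L) ⟨fun x y => ?_⟩
  have hmem (z : L) : z ∈ H := by
    rw [← LieSubalgebra.mem_toLieSubmodule, htop]; trivial
  exact coe_lie_coe_eq_zero (⟨x, hmem x⟩ : H) ⟨y, hmem y⟩

/-- Over an algebraically closed field of characteristic zero, every invariant alternating map on
a simple Lie algebra is a multiple of the bracket. -/
lemma exists_eq_smul_bracketBilin {K L : Type*} [Field K] [CharZero K] [IsAlgClosed K] [LieRing L]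
    [LieAlgebra K L] [FiniteDimensional K L] [IsSimple K L] {F : L →ₗ[K] L →ₗ[K] L}
    (hF : F ∈ invAltMaps K L) : ∃ c : K, F = c • bracketBilin K L := by
  obtain ⟨x, hx⟩ := exists_isCartanSubalgebra_engel K L
  set H := LieSubalgebra.engel K x
  obtain ⟨α, hα⟩ := exists_weight_isNonZero H
  obtain ⟨c, hc⟩ := exists_apply_eq_smul_lie hF hα
  refine ⟨c, sub_eq_zero.1 (eq_zero_of_apply_rootSpace_eq_zero H
    (sub_mem hF (Submodule.smul_mem _ c (bracketBilin_mem_invAltMaps K L))) hα fun h y hy => ?_)⟩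
  simp [hc h y hy, bracketBilin]

section BaseChange

variable {K L R : Type*} [Field K] [LieRing L] [LieAlgebra K L] [CommRing R] [Algebra K R]

/-- Contracting the left factor of `R ⊗ L` with a linear functional. -/
noncomputable def contractLeftFactor (ψ : R →ₗ[K] K) : R ⊗[K] L →ₗ[K] L :=
  (TensorProduct.lid K L).toLinearMap ∘ₗ ψ.rTensor L

@[simp]
lemma contractLeftFactor_tmul (ψ : R →ₗ[K] K) (r : R) (x : L) :
    contractLeftFactor ψ (r ⊗ₜ[K] x) = ψ r • x := by
  simp [contractLeftFactor]

lemma contractLeftFactor_one_tmul_lie (ψ : R →ₗ[K] K) (z : L) (t : R ⊗[K] L) :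
    contractLeftFactor ψ ⁅(1 : R) ⊗ₜ[K] z, t⁆ = ⁅z, contractLeftFactor ψ t⁆ := by
  induction t with
  | zero => simp
  | add s t hs ht => simp [hs, ht]
  | tmul r x => simp

lemma eq_zero_of_forall_contractLeftFactor_eq_zero {t : R ⊗[K] L}
    (ht : ∀ ψ : R →ₗ[K] K, contractLeftFactor ψ t = 0) : t = 0 := by
  let b := Module.Basis.ofVectorSpace K L
  have hb (ψ : R →ₗ[K] K) (s : R ⊗[K] L) (i) :
      ψ ((Algebra.TensorProduct.basis R b).repr s i) = b.repr (contractLeftFactor ψ s) i := by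
    induction s with
    | zero => simp
    | add s t hs ht => simp [hs, ht]
    | tmul r x =>
      rw [Algebra.TensorProduct.basis_repr_tmul, contractLeftFactor_tmul, Finsupp.smul_apply,
        Finsupp.mapRange_apply, smul_eq_mul, ← Algebra.commutes, ← Algebra.smul_def, map_smul,
        map_smul, Finsupp.smul_apply, smul_eq_mul, smul_eq_mul, mul_comm]
  refine (Algebra.TensorProduct.basis R b).ext_elem fun i => ?_
  rw [map_zero, Finsupp.zero_apply]
  refine (Module.forall_dual_apply_eq_zero_iff K _).1 fun ψ => ?_
  rw [hb, ht, map_zero, Finsupp.zero_apply]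

/-- The bilinear map on `L` obtained from one on `R ⊗ L` by contracting its values with a linear
functional on `R`. -/
noncomputable def contractBilin (ψ : R →ₗ[K] K)
    (F : R ⊗[K] L →ₗ[R] R ⊗[K] L →ₗ[R] R ⊗[K] L) : L →ₗ[K] L →ₗ[K] L :=
  LinearMap.mk₂ K (fun a b => contractLeftFactor ψ (F (1 ⊗ₜ a) (1 ⊗ₜ b)))
    (fun _ _ _ => by simp [TensorProduct.tmul_add])
    (fun c a b => by
      rw [TensorProduct.tmul_smul, F.map_smul_of_tower, LinearMap.smul_apply, map_smul])
    (fun _ _ _ => by simp [TensorProduct.tmul_add])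
    (fun c a b => by
      rw [TensorProduct.tmul_smul, LinearMap.map_smul_of_tower, map_smul])

lemma contractBilin_mem_invAltMaps (ψ : R →ₗ[K] K)
    {F : R ⊗[K] L →ₗ[R] R ⊗[K] L →ₗ[R] R ⊗[K] L} (hF : F ∈ invAltMaps R (R ⊗[K] L)) :
    contractBilin ψ F ∈ invAltMaps K L := by
  refine ⟨fun x => ?_, fun z x y => ?_⟩
  · simp [contractBilin, hF.1]
  · have := congrArg (contractLeftFactor ψ) (hF.2 (1 ⊗ₜ z) (1 ⊗ₜ x) (1 ⊗ₜ y))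
    rw [contractLeftFactor_one_tmul_lie] at this
    simpa [contractBilin] using this

end BaseChange

/-- Let `L` be a finite-dimensional simple Lie algebra over `ℂ` and `R` a nontrivial
commutative `ℂ`-algebra.  The `R`-module of alternating invariant `R`-bilinear maps on the
base change `R ⊗[ℂ] L` is free of rank one, generated by the Lie bracket of `R ⊗[ℂ] L`. -/
theorem invAltMaps_baseChange_free_rank_one
    (L : Type*) [LieRing L] [LieAlgebra ℂ L] [FiniteDimensional ℂ L]
    [LieAlgebra.IsSimple ℂ L]
    (R : Type*) [CommRing R] [Nontrivial R] [Algebra ℂ R] :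
    bracketBilin R (R ⊗[ℂ] L) ∈ invAltMaps R (R ⊗[ℂ] L) ∧
      ∀ f ∈ invAltMaps R (R ⊗[ℂ] L), ∃! r : R, f = r • bracketBilin R (R ⊗[ℂ] L) := by
  refine ⟨bracketBilin_mem_invAltMaps R _, fun F hF => ?_⟩
  obtain ⟨x, y, hxy⟩ : ∃ x y : L, ⁅x, y⁆ ≠ 0 := by
    by_contra! h
    exact IsSimple.non_abelian (R := ℂ) (L := L) ⟨h⟩
  obtain ⟨φ, hφ⟩ := Module.Projective.exists_dual_eq_one ℂ hxy
  let π : R ⊗[ℂ] L →ₗ[ℂ] R := (TensorProduct.rid ℂ R).toLinearMap ∘ₗ φ.lTensor R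
  have hπ (r : R) (a : L) : π (r ⊗ₜ a) = φ a • r := by simp [π]
  have hπψ (ψ : R →ₗ[ℂ] ℂ) (t : R ⊗[ℂ] L) : ψ (π t) = φ (contractLeftFactor ψ t) := by
    induction t with
    | zero => simp
    | add s t hs ht => simp [hs, ht]
    | tmul r a => simp [hπ, mul_comm]
  let r : R := π (F (1 ⊗ₜ x) (1 ⊗ₜ y))
  have hone (a b : L) : F (1 ⊗ₜ a) (1 ⊗ₜ b) = r ⊗ₜ ⁅a, b⁆ := by
    refine sub_eq_zero.1 (eq_zero_of_forall_contractLeftFactor_eq_zero fun ψ => ?_)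
    obtain ⟨c, hc⟩ := exists_eq_smul_bracketBilin (contractBilin_mem_invAltMaps ψ hF)
    have hc' (a b : L) : contractLeftFactor ψ (F (1 ⊗ₜ a) (1 ⊗ₜ b)) = c • ⁅a, b⁆ :=
      LinearMap.congr_fun (LinearMap.congr_fun hc a) b
    have hr : ψ r = c := by rw [hπψ, hc', map_smul, hφ, smul_eq_mul, mul_one]
    rw [map_sub, hc', contractLeftFactor_tmul, hr, sub_self]
  have hsmul (s : R) (a : L) : s ⊗ₜ[ℂ] a = s • ((1 : R) ⊗ₜ[ℂ] a) := by
    rw [TensorProduct.smul_tmul', smul_eq_mul, mul_one]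
  refine ⟨r, ?_, fun s hs => ?_⟩
  · ext a b
    simp [hone, bracketBilin, TensorProduct.smul_tmul']
  · have h1 := hone x y
    rw [hs] at h1
    simpa [bracketBilin, TensorProduct.smul_tmul', hπ, hφ] using congrArg π h1
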